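/- For 1 ≤ l < j ≤ m and 1 ≤ k ≤ n_l+1, the iterated pullback p_j^* ∘ ⋯ ∘ p_{l+1}^*(W_{l,k}/W_{l,k-1}) → B_j^{quo} of the tautological quotient line bundle on B_l^{quo} is isomorphic to the line bundle η(0,0,…,0, e_k, 0,…,0) → B_j^{quo} (with j−l trailing zero vectors), where e_k = (0,…,0,1,0,…,0) ∈ ℤ^{n_l+1} has 1 in the k-th place and all other entries zero. -/

import Mathlib

noncomputable section

open Matrix Finset

/-- `GL(d, ℂ)` realized as the unit group of the matrix ring. -/
abbrev GLC (d : ℕ) : Type := (Matrix (Fin d) (Fin d) ℂ)ˣ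

/-- Upper triangular (BorelT) condition on an invertible matrix. -/
def IsUpper {d : ℕ} (g : GLC d) : Prop :=
  Matrix.BlockTriangular (g : Matrix (Fin d) (Fin d) ℂ) id

/-- The BorelT subgroup `B_{GL(d)}` of upper triangular invertible matrices. -/
abbrev BorelT (d : ℕ) : Type := {g : GLC d // IsUpper g}

lemma BorelT.diag_ne_zero {d : ℕ} (b : BorelT d) (i : Fin d) :
    ((b : GLC d) : Matrix (Fin d) (Fin d) ℂ) i i ≠ 0 := by
  have hdet : ((b : GLC d) : Matrix (Fin d) (Fin d) ℂ).det =
      ∏ j, ((b : GLC d) : Matrix (Fin d) (Fin d) ℂ) j j :=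
    Matrix.det_of_upperTriangular b.2
  have hu : IsUnit ((b : GLC d) : Matrix (Fin d) (Fin d) ℂ).det :=
    (Matrix.isUnit_iff_isUnit_det _).1 (b : GLC d).isUnit
  intro h
  rw [hdet] at hu
  have hz : (∏ j, ((b : GLC d) : Matrix (Fin d) (Fin d) ℂ) j j) = 0 :=
    Finset.prod_eq_zero (Finset.mem_univ i) h
  rw [hz] at hu
  exact hu.ne_zero rfl

/-- `Γ_l(b)^a`: the character of the diagonal torus with exponent vector `a : ℤ^d`,
evaluated on the diagonal part of `b`. -/
def charPow {d : ℕ} (b : BorelT d) (a : Fin d → ℤ) : ℂ :=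
  ∏ i, (((b : GLC d) : Matrix (Fin d) (Fin d) ℂ) i i) ^ (a i)

lemma charPow_ne_zero {d : ℕ} (b : BorelT d) (a : Fin d → ℤ) : charPow b a ≠ 0 :=
  Finset.prod_ne_zero_iff.2 fun i _ => zpow_ne_zero _ (BorelT.diag_ne_zero b i)

/-- The invertible diagonal matrix with prescribed nonvanishing diagonal entries. -/
def diagGL {d : ℕ} (v : Fin d → ℂ) (hv : ∀ i, v i ≠ 0) : GLC d where
  val := Matrix.diagonal v
  inv := Matrix.diagonal fun i => (v i)⁻¹
  val_inv := by
    rw [Matrix.diagonal_mul_diagonal]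
    have : (fun i => v i * (v i)⁻¹) = fun _ => (1 : ℂ) :=
      funext fun i => mul_inv_cancel₀ (hv i)
    rw [this, Matrix.diagonal_one]
  inv_val := by
    rw [Matrix.diagonal_mul_diagonal]
    have : (fun i => (v i)⁻¹ * v i) = fun _ => (1 : ℂ) :=
      funext fun i => inv_mul_cancel₀ (hv i)
    rw [this, Matrix.diagonal_one]

variable {m : ℕ}

/-- The twisting matrix `Ψ_1^{(j)}(b_1)⋯Ψ_{j-1}^{(j)}(b_{j-1})`: the invertible
diagonal matrix whose `k`-th entry is `∏_{l<j} Γ_l(b_l)^{(k-th row of P_l^{(j)})}`. -/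
def twist (n : Fin m → ℕ)
    (P : ∀ l j : Fin m, l < j → Matrix (Fin (n j + 1)) (Fin (n l + 1)) ℤ)
    (b : ∀ l, BorelT (n l + 1)) (j : Fin m) : GLC (n j + 1) :=
  diagGL (fun k => ∏ l : {l : Fin m // l < j}, charPow (b l.1) (fun i => P l.1 j l.2 k i))
    (fun _ => Finset.prod_ne_zero_iff.2 fun l _ => charPow_ne_zero _ _)

/-- The right action `Φ^𝔓` of `∏_l B_{GL(n_l+1)}` on `∏_l GL(n_l+1)`:
`(g_1,…,g_m)·(b_1,…,b_m) = (…, (Ψ_1^{(j)}(b_1))⁻¹⋯(Ψ_{j-1}^{(j)}(b_{j-1}))⁻¹ g_j b_j, …)`. -/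
def Phi (n : Fin m → ℕ)
    (P : ∀ l j : Fin m, l < j → Matrix (Fin (n j + 1)) (Fin (n l + 1)) ℤ)
    (g : ∀ l, GLC (n l + 1)) (b : ∀ l, BorelT (n l + 1)) : ∀ l, GLC (n l + 1) :=
  fun j => (twist n P b j)⁻¹ * g j * (b j : GLC (n j + 1))

/-- Orbit relation of the right action `Φ^𝔓`. -/
def PhiRel (n : Fin m → ℕ)
    (P : ∀ l j : Fin m, l < j → Matrix (Fin (n j + 1)) (Fin (n l + 1)) ℤ)
    (g g' : ∀ l, GLC (n l + 1)) : Prop :=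
  ∃ b : ∀ l, BorelT (n l + 1), Phi n P g b = g'

/-- The `m`-stage flag Bott manifold `B_m^{quo}(𝔓) = ∏_l GL(n_l+1) / Φ^𝔓`,
with the quotient topology. -/
def FBSpace (n : Fin m → ℕ)
    (P : ∀ l j : Fin m, l < j → Matrix (Fin (n j + 1)) (Fin (n l + 1)) ℤ) : Type :=
  Quot (PhiRel n P)

instance (n : Fin m → ℕ) (P : ∀ l j : Fin m, l < j → Matrix (Fin (n j + 1)) (Fin (n l + 1)) ℤ) :
    TopologicalSpace (FBSpace n P) :=
  inferInstanceAs (TopologicalSpace (Quot _))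

/-- The line bundle `η(v_1,…,v_m)` over `B_m^{quo}`, with an arbitrary cocycle
`c : b ↦ b_1^{-v_1}⋯b_m^{-v_m}` prescribed abstractly: total space of the quotient of
`∏_l GL(n_l+1) × ℂ` by the action `(g,w)·b = (Φ(g,b), c(b)·w)`. -/
def EtaTotalC (n : Fin m → ℕ)
    (P : ∀ l j : Fin m, l < j → Matrix (Fin (n j + 1)) (Fin (n l + 1)) ℤ)
    (c : (∀ l, BorelT (n l + 1)) → ℂ) : Type :=
  Quot (fun p q : (∀ l, GLC (n l + 1)) × ℂ =>
    ∃ b : ∀ l, BorelT (n l + 1), Phi n P p.1 b = q.1 ∧ q.2 = c b * p.2)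

instance (n : Fin m → ℕ) (P : ∀ l j : Fin m, l < j → Matrix (Fin (n j + 1)) (Fin (n l + 1)) ℤ)
    (c : (∀ l, BorelT (n l + 1)) → ℂ) : TopologicalSpace (EtaTotalC n P c) :=
  inferInstanceAs (TopologicalSpace (Quot _))

/-- The cocycle `b ↦ b_1^{-v_1}⋯b_m^{-v_m}` of the line bundle `η(v_1,…,v_m)`. -/
def etaCocycle (n : Fin m → ℕ) (v : ∀ l : Fin m, Fin (n l + 1) → ℤ)
    (b : ∀ l, BorelT (n l + 1)) : ℂ :=
  ∏ l, charPow (b l) (fun i => -(v l i))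

/-- The total space of the line bundle `η(v_1,…,v_m)` over `B_m^{quo}`. -/
def EtaTotal (n : Fin m → ℕ)
    (P : ∀ l j : Fin m, l < j → Matrix (Fin (n j + 1)) (Fin (n l + 1)) ℤ)
    (v : ∀ l : Fin m, Fin (n l + 1) → ℤ) : Type :=
  EtaTotalC n P (etaCocycle n v)

instance (n : Fin m → ℕ) (P : ∀ l j : Fin m, l < j → Matrix (Fin (n j + 1)) (Fin (n l + 1)) ℤ)
    (v : ∀ l : Fin m, Fin (n l + 1) → ℤ) : TopologicalSpace (EtaTotal n P v) :=
  inferInstanceAs (TopologicalSpace (Quot _))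

/-- Bundle projection `η(v_1,…,v_m) → B_m^{quo}`. -/
def etaProj (n : Fin m → ℕ)
    (P : ∀ l j : Fin m, l < j → Matrix (Fin (n j + 1)) (Fin (n l + 1)) ℤ)
    (c : (∀ l, BorelT (n l + 1)) → ℂ) : EtaTotalC n P c → FBSpace n P :=
  Quot.lift (fun p => Quot.mk _ p.1) (fun _ _ ⟨b, hb, _⟩ => Quot.sound ⟨b, hb⟩)

/-- Fiberwise scalar multiplication on the total space of `η(v_1,…,v_m)`. -/
def etaSMul (n : Fin m → ℕ)
    (P : ∀ l j : Fin m, l < j → Matrix (Fin (n j + 1)) (Fin (n l + 1)) ℤ)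
    (c : (∀ l, BorelT (n l + 1)) → ℂ) (z : ℂ) : EtaTotalC n P c → EtaTotalC n P c :=
  Quot.map (fun p => (p.1, z * p.2))
    (fun p q ⟨b, hb, hw⟩ => ⟨b, hb, by dsimp only; rw [hw]; ring⟩)

/-- An isomorphism of (complex) line bundles presented by total spaces with
projections and fiberwise scalar multiplications: a homeomorphism of total spaces
commuting with the projections and with scalar multiplication. -/
structure LineBundleIso {B : Type} [TopologicalSpace B]
    (E F : Type) [TopologicalSpace E] [TopologicalSpace F]
    (pE : E → B) (pF : F → B) (sE : ℂ → E → E) (sF : ℂ → F → F) where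
  toHomeomorph : E ≃ₜ F
  map_proj : ∀ e, pF (toHomeomorph e) = pE e
  map_smul : ∀ z e, toHomeomorph (sE z e) = sF z (toHomeomorph e)

end
noncomputable section Trunc

lemma diagGL_congr {d : ℕ} {v v' : Fin d → ℂ} (hv : ∀ i, v i ≠ 0) (hv' : ∀ i, v' i ≠ 0)
    (h : v = v') : diagGL v hv = diagGL v' hv' := by subst h; rfl

variable {m : ℕ} (n : Fin m → ℕ)
  (P : ∀ l j : Fin m, l < j → Matrix (Fin (n j + 1)) (Fin (n l + 1)) ℤ)
  {j : ℕ} (hj : j ≤ m)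

/-- Truncation of the dimension data to the first `j` stages. -/
abbrev nTr : Fin j → ℕ := fun l => n (Fin.castLE hj l)

/-- Truncation of the matrix data `𝔓` to the first `j` stages. -/
abbrev PTr : ∀ l i : Fin j, l < i →
    Matrix (Fin (nTr n hj i + 1)) (Fin (nTr n hj l + 1)) ℤ :=
  fun l i h => P (Fin.castLE hj l) (Fin.castLE hj i) h

/-- Reindexing of the stages `< l` under truncation. -/
def truncEquiv (l : Fin j) : {l' : Fin j // l' < l} ≃ {l' : Fin m // l' < Fin.castLE hj l} where
  toFun x := ⟨Fin.castLE hj x.1, x.2⟩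
  invFun y := ⟨⟨y.1.1, lt_trans y.2 l.isLt⟩, y.2⟩
  left_inv x := Subtype.ext (Fin.ext rfl)
  right_inv y := Subtype.ext (Fin.ext rfl)

lemma twist_trunc (b : ∀ l : Fin m, BorelT (n l + 1)) (l : Fin j) :
    twist (nTr n hj) (PTr n P hj) (fun l' => b (Fin.castLE hj l')) l
      = twist n P b (Fin.castLE hj l) := by
  apply diagGL_congr
  funext k
  exact Fintype.prod_equiv (truncEquiv hj l)
    (fun l' => charPow (b (Fin.castLE hj l'.1)) (fun i => PTr n P hj l'.1 l l'.2 k i))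
    (fun l' => charPow (b l'.1) (fun i => P l'.1 (Fin.castLE hj l) l'.2 k i))
    (fun x => rfl)

lemma Phi_trunc (g : ∀ l : Fin m, GLC (n l + 1)) (b : ∀ l : Fin m, BorelT (n l + 1)) :
    Phi (nTr n hj) (PTr n P hj) (fun l => g (Fin.castLE hj l)) (fun l => b (Fin.castLE hj l))
      = fun l => Phi n P g b (Fin.castLE hj l) := by
  funext l
  show (twist (nTr n hj) (PTr n P hj) (fun l' => b (Fin.castLE hj l')) l)⁻¹ *
      g (Fin.castLE hj l) * (b (Fin.castLE hj l) : GLC _) = _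
  rw [twist_trunc]
  rfl

/-- The composite projection `p_{j+1}^* ∘ ⋯ ∘ p_m^*` of the flag Bott tower,
`B_m^{quo} → B_j^{quo}`, induced by truncating representatives. -/
def truncMap : FBSpace n P → FBSpace (nTr n hj) (PTr n P hj) :=
  Quot.lift (fun g => Quot.mk _ (fun l => g (Fin.castLE hj l)))
    (fun g g' ⟨b, hb⟩ => Quot.sound ⟨fun l => b (Fin.castLE hj l), by
      rw [Phi_trunc n P hj g b, hb]⟩)

lemma continuous_truncMap : Continuous (truncMap n P hj) :=
  continuous_quot_lift _
    (continuous_quot_mk.comp (continuous_pi fun l => continuous_apply (Fin.castLE hj l)))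

/-- Scalar multiplication commutes with the projection of `η`. -/
lemma etaProj_smul (n : Fin m → ℕ)
    (P : ∀ l j : Fin m, l < j → Matrix (Fin (n j + 1)) (Fin (n l + 1)) ℤ)
    (c : (∀ l, BorelT (n l + 1)) → ℂ) (z : ℂ) (x : EtaTotalC n P c) :
    etaProj n P c (etaSMul n P c z x) = etaProj n P c x :=
  Quot.inductionOn x fun _ => rfl

/-- The total space of the pullback of a bundle with total space `E → B`
along `f : B' → B`. -/
abbrev PullbackTotal {B B' E : Type} (f : B' → B) (pE : E → B) : Type :=
  {q : B' × E // f q.1 = pE q.2}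

/-- Projection of the pullback bundle. -/
def pbProj {B B' E : Type} (f : B' → B) (pE : E → B) : PullbackTotal f pE → B' :=
  fun q => q.1.1

/-- Fiberwise scalar multiplication on the pullback bundle. -/
def pbSMul {B B' E : Type} (f : B' → B) (pE : E → B) (sE : ℂ → E → E)
    (hsE : ∀ z e, pE (sE z e) = pE e) (z : ℂ) :
    PullbackTotal f pE → PullbackTotal f pE :=
  fun q => ⟨(q.1.1, sE z q.1.2), q.2.trans (hsE z q.1.2).symm⟩

end Trunc
noncomputable section WQuot

variable {m : ℕ}

/-- The span of the first `k` columns of a matrix `A`. -/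
def colSpan {d : ℕ} (A : Matrix (Fin d) (Fin d) ℂ) (k : ℕ) : Submodule ℂ (Fin d → ℂ) :=
  Submodule.span ℂ (A.transpose '' {i : Fin d | (i : ℕ) < k})

variable (n : Fin (m+1) → ℕ)
  (P : ∀ l j : Fin (m+1), l < j → Matrix (Fin (n j + 1)) (Fin (n l + 1)) ℤ)
  (k : Fin (n (Fin.last m) + 1))

/-- Points of the total space of the tautological subquotient line bundle
`W_{j,k}/W_{j,k-1}` on `B_j^{quo}` (with `j = m+1` the last stage), before identification:
a representative `g ∈ ∏_{l≤j} GL(n_l+1)` (whose class is a point of `B_j^{quo}`, i.e. a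
point of `B_{j-1}^{quo}` with a full flag `V_• ` in `η^{(j)}`, `V_k` being spanned by the
first `k` columns of `g_j` in the `g`-chart of the fiber of `η^{(j)}`), together with a
vector of `V_k` representing a class in `V_k/V_{k-1}`. -/
abbrev WQuotCarrier : Type :=
  {p : (∀ l : Fin (m+1), GLC (n l + 1)) × (Fin (n (Fin.last m) + 1) → ℂ) //
    p.2 ∈ colSpan ((p.1 (Fin.last m) : Matrix _ _ ℂ)) ((k : ℕ) + 1)}

/-- The identification on `WQuotCarrier`: `(g, w) ∼ (Φ(g,b), w')` whenever the transport
`D(b)⁻¹ w` of `w` to the `Φ(g,b)`-chart (here `D(b) = Ψ_1^{(j)}(b_1)⋯Ψ_{j-1}^{(j)}(b_{j-1})`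
is the twisting matrix) agrees with `w'` modulo `V_{k-1}`, i.e. modulo the span of the
first `k-1` columns of `Φ(g,b)_j`. -/
def WQuotRel (p q : WQuotCarrier n k) : Prop :=
  ∃ b : ∀ l : Fin (m+1), BorelT (n l + 1),
    Phi n P p.1.1 b = q.1.1 ∧
    q.1.2 - ((twist n P b (Fin.last m))⁻¹).val.mulVec p.1.2 ∈
      colSpan ((q.1.1 (Fin.last m) : Matrix _ _ ℂ)) (k : ℕ)

/-- The total space of the tautological quotient line bundle `W_{j,k}/W_{j,k-1} → B_j^{quo}`. -/
def WQuotTotal : Type := Quot (WQuotRel n P k)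

instance : TopologicalSpace (WQuotTotal n P k) := inferInstanceAs (TopologicalSpace (Quot _))

/-- Projection of `W_{j,k}/W_{j,k-1}` to `B_j^{quo}`. -/
def wQuotProj : WQuotTotal n P k → FBSpace n P :=
  Quot.lift (fun p => Quot.mk _ p.1.1) (fun _ _ ⟨b, hb, _⟩ => Quot.sound ⟨b, hb⟩)

/-- Fiberwise scalar multiplication on `W_{j,k}/W_{j,k-1}`. -/
def wQuotSMul (z : ℂ) : WQuotTotal n P k → WQuotTotal n P k :=
  Quot.map (fun p => ⟨(p.1.1, z • p.1.2), Submodule.smul_mem _ z p.2⟩)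
    (fun p q => fun ⟨b, hb, hw⟩ => ⟨b, hb, by
      show z • q.1.2 - ((twist n P b (Fin.last m))⁻¹).val.mulVec (z • p.1.2) ∈ _
      rw [Matrix.mulVec_smul, ← smul_sub]
      exact Submodule.smul_mem _ _ hw⟩)


/-- Scalar multiplication commutes with the projection of `W_{j,k}/W_{j,k-1}`. -/
lemma wQuotProj_smul (z : ℂ) (x : WQuotTotal n P k) :
    wQuotProj n P k (wQuotSMul n P k z x) = wQuotProj n P k x :=
  Quot.inductionOn x fun _ => rfl

end WQuot

noncomputable section Aux1

open Matrix Topology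

/-- The subgroup of upper triangular matrices. -/
def borelSub (d : ℕ) : Subgroup (GLC d) where
  carrier := {g | IsUpper g}
  mul_mem' := fun {a b} ha hb => by
    show Matrix.BlockTriangular ((a * b : GLC d) : Matrix (Fin d) (Fin d) ℂ) id
    rw [Units.val_mul]
    exact Matrix.BlockTriangular.mul ha hb
  one_mem' := by
    show Matrix.BlockTriangular ((1 : GLC d) : Matrix (Fin d) (Fin d) ℂ) id
    rw [Units.val_one]
    exact Matrix.blockTriangular_one
  inv_mem' := fun {a} ha => by
    show Matrix.BlockTriangular ((a⁻¹ : GLC d) : Matrix (Fin d) (Fin d) ℂ) id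
    rw [Matrix.coe_units_inv]
    have : Invertible (a : Matrix (Fin d) (Fin d) ℂ) := a.invertible
    exact Matrix.blockTriangular_inv_of_blockTriangular ha

instance borelGroup (d : ℕ) : Group (BorelT d) := inferInstanceAs (Group (borelSub d))

lemma borel_coe_mul {d : ℕ} (a b : BorelT d) :
    ((a * b : BorelT d) : GLC d) = (a : GLC d) * (b : GLC d) := rfl

lemma borel_coe_one {d : ℕ} : ((1 : BorelT d) : GLC d) = 1 := rfl

lemma borel_coe_inv {d : ℕ} (a : BorelT d) : ((a⁻¹ : BorelT d) : GLC d) = (a : GLC d)⁻¹ := rfl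

lemma borel_diag_mul {d : ℕ} (a b : BorelT d) (i : Fin d) :
    ((a * b : BorelT d) : GLC d).val i i = (a : GLC d).val i i * (b : GLC d).val i i := by
  rw [borel_coe_mul, Units.val_mul, Matrix.mul_apply]
  rw [Finset.sum_eq_single i]
  · intro j _ hj
    rcases lt_or_gt_of_ne hj with h | h
    · have : (a : GLC d).val i j = 0 := a.2 h
      rw [this, zero_mul]
    · have : (b : GLC d).val j i = 0 := b.2 h
      rw [this, mul_zero]
  · simp

lemma borel_diag_one {d : ℕ} (i : Fin d) : ((1 : BorelT d) : GLC d).val i i = 1 := by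
  rw [borel_coe_one, Units.val_one, Matrix.one_apply_eq]

lemma borel_diag_inv {d : ℕ} (a : BorelT d) (i : Fin d) :
    ((a⁻¹ : BorelT d) : GLC d).val i i = ((a : GLC d).val i i)⁻¹ := by
  apply eq_inv_of_mul_eq_one_left
  rw [← borel_diag_mul, inv_mul_cancel, borel_diag_one]

lemma charPow_mul {d : ℕ} (a b : BorelT d) (v : Fin d → ℤ) :
    charPow (a * b) v = charPow a v * charPow b v := by
  unfold charPow
  rw [← Finset.prod_mul_distrib]
  refine Finset.prod_congr rfl fun i _ => ?_
  rw [borel_diag_mul, mul_zpow]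

lemma charPow_one {d : ℕ} (v : Fin d → ℤ) : charPow (1 : BorelT d) v = 1 := by
  unfold charPow
  refine Finset.prod_eq_one fun i _ => ?_
  rw [borel_diag_one, _root_.one_zpow]

variable {m : ℕ} (n : Fin m → ℕ)
  (P : ∀ l j : Fin m, l < j → Matrix (Fin (n j + 1)) (Fin (n l + 1)) ℤ)

lemma twist_mul (a b : ∀ l, BorelT (n l + 1)) (j : Fin m) :
    twist n P (a * b) j = twist n P a j * twist n P b j := by
  apply Units.ext
  rw [Units.val_mul]
  show Matrix.diagonal _ = Matrix.diagonal _ * Matrix.diagonal _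
  rw [Matrix.diagonal_mul_diagonal]
  congr 1
  funext k
  rw [← Finset.prod_mul_distrib]
  exact Finset.prod_congr rfl fun l _ => charPow_mul _ _ _

lemma twist_one (j : Fin m) : twist n P 1 j = 1 := by
  apply Units.ext
  rw [Units.val_one]
  show Matrix.diagonal _ = _
  rw [← Matrix.diagonal_one]
  congr 1
  funext k
  exact Finset.prod_eq_one fun l _ => charPow_one _

lemma twist_comm (a b : ∀ l, BorelT (n l + 1)) (j : Fin m) :
    twist n P a j * twist n P b j = twist n P b j * twist n P a j := by
  apply Units.ext
  rw [Units.val_mul, Units.val_mul]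
  show Matrix.diagonal _ * Matrix.diagonal _ = Matrix.diagonal _ * Matrix.diagonal _
  rw [Matrix.diagonal_mul_diagonal, Matrix.diagonal_mul_diagonal]
  congr 1
  funext k
  exact mul_comm _ _

lemma twist_congr (a b : ∀ l, BorelT (n l + 1)) (j : Fin m) (h : ∀ l, l < j → a l = b l) :
    twist n P a j = twist n P b j := by
  apply diagGL_congr
  funext k
  refine Finset.prod_congr rfl fun l _ => ?_
  rw [h l.1 l.2]

lemma Phi_mul (g : ∀ l, GLC (n l + 1)) (a b : ∀ l, BorelT (n l + 1)) :
    Phi n P (Phi n P g a) b = Phi n P g (a * b) := by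
  funext j
  show (twist n P b j)⁻¹ * ((twist n P a j)⁻¹ * g j * (a j : GLC _)) * (b j : GLC _)
    = (twist n P (a * b) j)⁻¹ * g j * ((a j : GLC _) * (b j : GLC _))
  rw [twist_mul, _root_.mul_inv_rev]
  simp only [mul_assoc]

lemma Phi_one (g : ∀ l, GLC (n l + 1)) : Phi n P g 1 = g := by
  funext j
  show (twist n P 1 j)⁻¹ * g j * 1 = g j
  rw [twist_one, inv_one, one_mul, mul_one]

lemma Phi_solve {g g' : ∀ l, GLC (n l + 1)} {b : ∀ l, BorelT (n l + 1)}
    (h : Phi n P g b = g') (j : Fin m) :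
    (b j : GLC (n j + 1)) = (g j)⁻¹ * twist n P b j * g' j := by
  rw [← h]
  show _ = (g j)⁻¹ * twist n P b j * ((twist n P b j)⁻¹ * g j * (b j : GLC _))
  group

lemma Phi_free (g : ∀ l, GLC (n l + 1)) (a b : ∀ l, BorelT (n l + 1))
    (h : Phi n P g a = Phi n P g b) : a = b := by
  funext j
  induction j using WellFoundedLT.induction with
  | ind j ih =>
    apply Subtype.ext
    rw [Phi_solve n P h j, Phi_solve n P rfl j, twist_congr n P a b j ih]

lemma continuous_Phi (b : ∀ l, BorelT (n l + 1)) : Continuous (fun g => Phi n P g b) := by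
  refine continuous_pi fun j => ?_
  exact (continuous_const.mul (continuous_apply j)).mul continuous_const

/-- The orbit-space facts used for both quotients. -/
lemma quot_act {Γ X : Type} [Group Γ] [TopologicalSpace X] (A : Γ → X → X)
    (h1 : ∀ x, A 1 x = x) (hm : ∀ a b x, A b (A a x) = A (a * b) x)
    (hc : ∀ a, Continuous (A a)) (r : X → X → Prop) (hr : ∀ x y, r x y ↔ ∃ b, A b x = y) :
    IsOpenQuotientMap (Quot.mk r) ∧ ∀ x y, Quot.mk r x = Quot.mk r y → ∃ b, A b x = y := by
  have key : ∀ x y, Quot.mk r x = Quot.mk r y → ∃ b, A b x = y := by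
    intro x y h
    have h' := Quot.eqvGen_exact h
    clear h
    induction h' with
    | rel x y h => exact (hr x y).1 h
    | refl x => exact ⟨1, h1 x⟩
    | symm x y _ ih =>
      obtain ⟨b, rfl⟩ := ih
      exact ⟨b⁻¹, by rw [hm, mul_inv_cancel, h1]⟩
    | trans x y z _ _ ih1 ih2 =>
      obtain ⟨b, rfl⟩ := ih1
      obtain ⟨c, rfl⟩ := ih2
      exact ⟨b * c, (hm _ _ _).symm⟩
  refine ⟨⟨Quot.mk_surjective, continuous_quot_mk, ?_⟩, key⟩
  intro U hU
  rw [← isQuotientMap_quot_mk.isOpen_preimage]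
  have : Quot.mk r ⁻¹' (Quot.mk r '' U) = ⋃ b, A b ⁻¹' U := by
    ext x
    simp only [Set.mem_preimage, Set.mem_image, Set.mem_iUnion]
    constructor
    · rintro ⟨y, hy, hxy⟩
      obtain ⟨b, hb⟩ := key x y hxy.symm
      exact ⟨b, by rw [hb]; exact hy⟩
    · rintro ⟨b, hb⟩
      exact ⟨_, hb, (Quot.sound ((hr _ _).2 ⟨b, rfl⟩)).symm⟩
  rw [this]
  exact isOpen_iUnion fun b => hU.preimage (hc b)

lemma fb_quot : IsOpenQuotientMap (Quot.mk (PhiRel n P)) ∧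
    ∀ g g', Quot.mk (PhiRel n P) g = Quot.mk (PhiRel n P) g' → ∃ b, Phi n P g b = g' :=
  quot_act (fun b g => Phi n P g b) (Phi_one n P) (fun a b g => Phi_mul n P g a b)
    (continuous_Phi n P) _ (fun _ _ => Iff.rfl)

/-- The relation defining `EtaTotalC`. -/
abbrev EtaRel (c : (∀ l, BorelT (n l + 1)) → ℂ) (p q : (∀ l, GLC (n l + 1)) × ℂ) : Prop :=
  ∃ b : ∀ l, BorelT (n l + 1), Phi n P p.1 b = q.1 ∧ q.2 = c b * p.2

lemma eta_quot (c : (∀ l, BorelT (n l + 1)) → ℂ) (c1 : c 1 = 1)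
    (cm : ∀ a b, c (a * b) = c a * c b) : IsOpenQuotientMap (Quot.mk (EtaRel n P c)) ∧
    ∀ p q, Quot.mk (EtaRel n P c) p = Quot.mk (EtaRel n P c) q →
      ∃ b, (Phi n P p.1 b, c b * p.2) = q := by
  refine quot_act (fun b p => (Phi n P p.1 b, c b * p.2)) ?_ ?_ ?_ _ ?_
  · intro p
    simp only [Phi_one, c1, one_mul]
  · intro a b p
    simp only [Phi_mul, cm, Prod.mk.injEq, true_and]
    ring
  · intro a
    exact ((continuous_Phi n P a).comp continuous_fst).prodMk
      (continuous_const.mul continuous_snd)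
  · intro p q
    constructor
    · rintro ⟨b, h1, h2⟩
      exact ⟨b, Prod.ext h1 h2.symm⟩
    · rintro ⟨b, rfl⟩
      exact ⟨b, rfl, rfl⟩

lemma continuous_charPow {Z : Type} [TopologicalSpace Z] {d : ℕ} (b : Z → BorelT d)
    (hb : Continuous fun z => ((b z : GLC d) : Matrix (Fin d) (Fin d) ℂ)) (v : Fin d → ℤ) :
    Continuous fun z => charPow (b z) v := by
  unfold charPow
  refine continuous_finsetProd _ fun i _ => ?_
  exact (hb.matrix_elem i i).zpow₀ _ fun z => Or.inl (BorelT.diag_ne_zero _ _)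

lemma continuous_solve {Z : Type} [TopologicalSpace Z] (g g' : Z → ∀ l, GLC (n l + 1))
    (b : Z → ∀ l, BorelT (n l + 1)) (hg : Continuous g) (hg' : Continuous g')
    (h : ∀ z, Phi n P (g z) (b z) = g' z) (j : Fin m) :
    Continuous fun z => (b z j : GLC (n j + 1)).val := by
  induction j using WellFoundedLT.induction with
  | ind j ih =>
    have : (fun z => (b z j : GLC (n j + 1)).val) = fun z =>
        ((g z j)⁻¹ : GLC (n j + 1)).val * (twist n P (b z) j).val * (g' z j).val := by
      funext z
      rw [Phi_solve n P (h z) j, Units.val_mul, Units.val_mul]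
    rw [this]
    have e1 : Continuous fun z => ((g z j)⁻¹ : GLC (n j + 1)).val :=
      Units.continuous_val.comp ((continuous_apply j).comp hg).inv
    have e2 : Continuous fun z => (g' z j).val :=
      Units.continuous_val.comp ((continuous_apply j).comp hg')
    refine (e1.mul ?_).mul e2
    refine Continuous.matrix_diagonal (continuous_pi fun k => ?_)
    refine continuous_finsetProd _ fun l _ => ?_
    exact continuous_charPow _ (ih l.1 l.2) _

end Aux1

noncomputable section Aux2

open Matrix Topology

lemma inv_mulVec_col {d : ℕ} (g : GLC d) (i : Fin d) :
    (g⁻¹).val *ᵥ (g.val.transpose i) = Pi.single i 1 := by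
  have : g.val.transpose i = g.val *ᵥ Pi.single i 1 := by
    funext x
    simp
  rw [this, Matrix.mulVec_mulVec, ← Units.val_mul, inv_mul_cancel, Units.val_one,
    Matrix.one_mulVec]

lemma mem_colSpan {d : ℕ} (g : GLC d) (j : ℕ) (w : Fin d → ℂ) :
    w ∈ colSpan g.val j ↔ ∀ i : Fin d, j ≤ (i : ℕ) → ((g⁻¹).val *ᵥ w) i = 0 := by
  constructor
  · intro hw i hi
    unfold colSpan at hw
    induction hw using Submodule.span_induction with
    | mem x hx =>
      obtain ⟨i', hi', rfl⟩ := hx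
      rw [inv_mulVec_col]
      have hne : i ≠ i' := by
        rintro rfl
        exact absurd hi' (not_lt.2 hi)
      simp [hne]
    | zero => simp
    | add x y _ _ hx hy => rw [Matrix.mulVec_add, Pi.add_apply, hx, hy, add_zero]
    | smul a x _ hx => rw [Matrix.mulVec_smul, Pi.smul_apply, hx, smul_zero]
  · intro h
    have e : w = g.val *ᵥ ((g⁻¹).val *ᵥ w) := by
      rw [Matrix.mulVec_mulVec, ← Units.val_mul, mul_inv_cancel, Units.val_one,
        Matrix.one_mulVec]
    have e2 : w = ∑ i, ((g⁻¹).val *ᵥ w) i • g.val.transpose i := by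
      conv_lhs => rw [e]
      funext x
      simp [Matrix.mulVec, dotProduct, mul_comm]
    rw [e2]
    refine Submodule.sum_mem _ fun i _ => ?_
    by_cases hi : j ≤ (i : ℕ)
    · rw [h i hi, zero_smul]
      exact Submodule.zero_mem _
    · exact Submodule.smul_mem _ _ (Submodule.subset_span ⟨i, not_le.1 hi, rfl⟩)

variable {m : ℕ} (n : Fin (m+1) → ℕ)
  (P : ∀ l j : Fin (m+1), l < j → Matrix (Fin (n j + 1)) (Fin (n l + 1)) ℤ)
  (k : Fin (n (Fin.last m) + 1))

/-- The inverse of the `k`-th diagonal entry at the last stage. -/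
def cLast (b : ∀ l, BorelT (n l + 1)) : ℂ :=
  ((b (Fin.last m) : GLC (n (Fin.last m) + 1)).val k k)⁻¹

lemma cLast_one : cLast n k 1 = 1 := by
  unfold cLast
  rw [Pi.one_apply, borel_diag_one, inv_one]

lemma cLast_mul (a b : ∀ l, BorelT (n l + 1)) :
    cLast n k (a * b) = cLast n k a * cLast n k b := by
  unfold cLast
  rw [Pi.mul_apply, borel_diag_mul, mul_inv]

lemma inv_Phi_mulVec {g g' : ∀ l, GLC (n l + 1)} {b : ∀ l, BorelT (n l + 1)}
    (h : Phi n P g b = g') (j : Fin (m+1)) (w : Fin (n j + 1) → ℂ) :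
    ((g' j)⁻¹ : GLC _).val *ᵥ (((twist n P b j)⁻¹).val *ᵥ w)
      = (((b j)⁻¹ : BorelT _) : GLC _).val *ᵥ (((g j)⁻¹ : GLC _).val *ᵥ w) := by
  rw [Matrix.mulVec_mulVec, Matrix.mulVec_mulVec, ← Units.val_mul, ← Units.val_mul,
    borel_coe_inv, Phi_solve n P h j]
  congr 2
  group

lemma upper_mulVec {d : ℕ} (b : BorelT d) (k : Fin d) (u : Fin d → ℂ)
    (hu : ∀ i : Fin d, k < i → u i = 0) :
    (∀ i : Fin d, k < i → ((b : GLC d).val *ᵥ u) i = 0) ∧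
    ((b : GLC d).val *ᵥ u) k = (b : GLC d).val k k * u k := by
  constructor
  · intro i hi
    show ∑ x, (b : GLC d).val i x * u x = 0
    refine Finset.sum_eq_zero fun x _ => ?_
    by_cases hx : k < x
    · rw [hu x hx, mul_zero]
    · have : (b : GLC d).val i x = 0 := b.2 (lt_of_le_of_lt (not_lt.1 hx) hi)
      rw [this, zero_mul]
  · show ∑ x, (b : GLC d).val k x * u x = _
    refine Finset.sum_eq_single k (fun x _ hx => ?_) (by simp)
    rcases lt_or_gt_of_ne hx with h | h
    · have : (b : GLC d).val k x = 0 := b.2 h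
      rw [this, zero_mul]
    · rw [hu x h, mul_zero]

/-- Coordinate map of `W_k/W_{k-1}`. -/
def wToEta : WQuotTotal n P k → EtaTotalC n P (cLast n k) :=
  Quot.map (fun p => (p.1.1, (((p.1.1 (Fin.last m))⁻¹ : GLC _).val *ᵥ p.1.2) k))
    (fun p q => fun ⟨b, hb, hw⟩ => ⟨b, hb, by
      have h1 := (mem_colSpan _ _ _).1 hw k le_rfl
      rw [Matrix.mulVec_sub, Pi.sub_apply, sub_eq_zero, inv_Phi_mulVec n P hb] at h1
      have h2 := (mem_colSpan _ _ _).1 p.2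
      rw [(upper_mulVec _ k _ (fun i hi => h2 i hi)).2, borel_diag_inv] at h1
      exact h1⟩)

lemma etaToW_mem (p : (∀ l, GLC (n l + 1)) × ℂ) :
    p.2 • (p.1 (Fin.last m)).val.transpose k ∈
      colSpan ((p.1 (Fin.last m) : Matrix _ _ ℂ)) ((k : ℕ) + 1) :=
  Submodule.smul_mem _ _ (Submodule.subset_span ⟨k, Nat.lt_succ_self _, rfl⟩)

/-- The inverse of the coordinate map. -/
def etaToW : EtaTotalC n P (cLast n k) → WQuotTotal n P k :=
  Quot.map (fun p => ⟨(p.1, p.2 • (p.1 (Fin.last m)).val.transpose k), etaToW_mem n k p⟩)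
    (fun p q => fun ⟨b, hb, hw⟩ => ⟨b, hb, by
      show q.2 • (q.1 (Fin.last m)).val.transpose k -
        ((twist n P b (Fin.last m))⁻¹).val *ᵥ (p.2 • (p.1 (Fin.last m)).val.transpose k) ∈ _
      rw [mem_colSpan]
      intro i hi
      have hs := upper_mulVec (b (Fin.last m))⁻¹ k (Pi.single k 1) (fun i hi => by simp [hi.ne'])
      rw [Matrix.mulVec_sub, inv_Phi_mulVec n P hb, Matrix.mulVec_smul, Matrix.mulVec_smul,
        Matrix.mulVec_smul, inv_mulVec_col, inv_mulVec_col, Pi.sub_apply, Pi.smul_apply,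
        Pi.smul_apply]
      rcases eq_or_lt_of_le hi with h | h
      · obtain rfl : k = i := Fin.ext h
        rw [hs.2, borel_diag_inv, hw]
        simp [cLast]
        ring
      · have h' : k < i := h
        rw [hs.1 i h']
        simp [h'.ne']⟩)

/-- `W_k/W_{k-1}` is homeomorphic to `η(0,…,0,e_k)`. -/
def wHomeo : WQuotTotal n P k ≃ₜ EtaTotalC n P (cLast n k) where
  toFun := wToEta n P k
  invFun := etaToW n P k
  left_inv := by
    intro x
    induction x using Quot.inductionOn with
    | h p =>
      refine Quot.sound ⟨1, Phi_one n P _, ?_⟩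
      rw [twist_one, inv_one, Units.val_one, Matrix.one_mulVec, mem_colSpan]
      intro i hi
      rw [Matrix.mulVec_sub, Matrix.mulVec_smul, inv_mulVec_col, Pi.sub_apply, Pi.smul_apply]
      rcases eq_or_lt_of_le hi with h | h
      · obtain rfl : k = i := Fin.ext h
        simp
      · have h' : k < i := h
        rw [(mem_colSpan _ _ _).1 p.2 i h]
        simp [h'.ne']
  right_inv := by
    intro x
    induction x using Quot.inductionOn with
    | h p =>
      refine congrArg (Quot.mk _) (Prod.ext rfl ?_)
      show (((p.1 (Fin.last m))⁻¹ : GLC _).val *ᵥ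
        (p.2 • (p.1 (Fin.last m)).val.transpose k)) k = p.2
      rw [Matrix.mulVec_smul, inv_mulVec_col]
      simp
  continuous_toFun := by
    refine continuous_quot_lift _ (continuous_quot_mk.comp ?_)
    have e0 : Continuous fun p : WQuotCarrier n k => p.1.1 :=
      continuous_fst.comp continuous_subtype_val
    refine e0.prodMk ?_
    refine (continuous_apply k).comp (Continuous.matrix_mulVec ?_ ?_)
    · exact Units.continuous_val.comp ((continuous_apply (Fin.last m)).comp e0).inv
    · exact continuous_snd.comp continuous_subtype_val
  continuous_invFun := by
    refine continuous_quot_lift _ (continuous_quot_mk.comp ?_)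
    refine Continuous.subtype_mk (continuous_fst.prodMk ?_) _
    refine continuous_snd.smul ?_
    have e1 : Continuous fun p : (∀ l, GLC (n l + 1)) × ℂ => (p.1 (Fin.last m)).val :=
      Units.continuous_val.comp ((continuous_apply (Fin.last m)).comp continuous_fst)
    exact (continuous_apply k).comp e1.matrix_transpose

lemma wHomeo_proj (x : WQuotTotal n P k) :
    etaProj n P (cLast n k) (wHomeo n P k x) = wQuotProj n P k x :=
  Quot.inductionOn x fun _ => rfl

lemma wHomeo_smul (z : ℂ) (x : WQuotTotal n P k) :
    wHomeo n P k (wQuotSMul n P k z x) = etaSMul n P (cLast n k) z (wHomeo n P k x) := by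
  induction x using Quot.inductionOn with
  | h p =>
    refine congrArg (Quot.mk _) (Prod.ext rfl ?_)
    show (((p.1.1 (Fin.last m))⁻¹ : GLC _).val *ᵥ (z • p.1.2)) k =
      z * (((p.1.1 (Fin.last m))⁻¹ : GLC _).val *ᵥ p.1.2) k
    rw [Matrix.mulVec_smul]
    rfl

end Aux2

noncomputable section Aux3

open Matrix Topology

variable {m : ℕ} (n : Fin m → ℕ)
  (P : ∀ l j : Fin m, l < j → Matrix (Fin (n j + 1)) (Fin (n l + 1)) ℤ)
  {j : ℕ} (hj : j + 1 ≤ m) (k : Fin (nTr n hj (Fin.last j) + 1))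
  (c : (∀ l, BorelT (n l + 1)) → ℂ)
  (hc : ∀ b, c b = cLast (nTr n hj) k (fun l => b (Fin.castLE hj l)))

/-- Truncation on line bundles. -/
def etaTrunc : EtaTotalC n P c → EtaTotalC (nTr n hj) (PTr n P hj) (cLast (nTr n hj) k) :=
  Quot.map (fun p => ((fun l => p.1 (Fin.castLE hj l)), p.2))
    (fun p q => fun ⟨b, hb, hw⟩ => ⟨fun l => b (Fin.castLE hj l), by
      dsimp only
      rw [Phi_trunc n P hj p.1 b, hb], by
      dsimp only
      rw [hw, hc]⟩)

lemma etaTrunc_proj (x : EtaTotalC n P c) :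
    truncMap n P hj (etaProj n P c x) = etaProj (nTr n hj) (PTr n P hj) (cLast (nTr n hj) k)
      (etaTrunc n P hj k c hc x) :=
  Quot.inductionOn x fun _ => rfl

/-- The comparison map to the pullback. -/
def toPB (x : EtaTotalC n P c) : PullbackTotal (truncMap n P hj)
    (etaProj (nTr n hj) (PTr n P hj) (cLast (nTr n hj) k)) :=
  ⟨(etaProj n P c x, etaTrunc n P hj k c hc x), etaTrunc_proj n P hj k c hc x⟩

lemma continuous_toPB : Continuous (toPB n P hj k c hc) := by
  refine Continuous.subtype_mk (Continuous.prodMk ?_ ?_) _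
  · exact continuous_quot_lift _ (continuous_quot_mk.comp continuous_fst)
  · refine continuous_quot_lift _ (continuous_quot_mk.comp (Continuous.prodMk ?_ continuous_snd))
    exact continuous_pi fun l => (continuous_apply (Fin.castLE hj l)).comp continuous_fst

lemma toPB_injective : Function.Injective (toPB n P hj k c hc) := by
  intro x y h
  induction x using Quot.inductionOn with
  | h p =>
  induction y using Quot.inductionOn with
  | h q =>
  have h1 : Quot.mk (PhiRel n P) p.1 = Quot.mk (PhiRel n P) q.1 :=
    congrArg (fun z => z.1.1) h
  have h2 := (eta_quot (nTr n hj) (PTr n P hj) (cLast (nTr n hj) k) (cLast_one _ k)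
    (cLast_mul _ k)).2 _ _ (congrArg (fun z => z.1.2) h)
  obtain ⟨a, ha⟩ := (fb_quot n P).2 _ _ h1
  obtain ⟨b, hb⟩ := h2
  have hb1 := congrArg Prod.fst hb
  have hb2 := congrArg Prod.snd hb
  dsimp only at hb1 hb2
  have hab : b = fun l => a (Fin.castLE hj l) := by
    apply Phi_free (nTr n hj) (PTr n P hj) (fun l => p.1 (Fin.castLE hj l))
    rw [hb1, Phi_trunc n P hj p.1 a, ha]
  refine Quot.sound ⟨a, ha, ?_⟩
  rw [hc, ← hab, hb2]

/-- The comparison homeomorphism. -/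
lemma toPB_homeo : ∃ e : EtaTotalC n P c ≃ₜ PullbackTotal (truncMap n P hj)
    (etaProj (nTr n hj) (PTr n P hj) (cLast (nTr n hj) k)), ∀ x, e x = toPB n P hj k c hc x := by
  let nl := nTr n hj
  let Pl := PTr n P hj
  let S : Set (FBSpace n P × EtaTotalC nl Pl (cLast nl k)) :=
    {q | truncMap n P hj q.1 = etaProj nl Pl (cLast nl k) q.2}
  let Q : (∀ l, GLC (n l + 1)) × ((∀ l, GLC (nl l + 1)) × ℂ) →
      FBSpace n P × EtaTotalC nl Pl (cLast nl k) :=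
    Prod.map (Quot.mk (PhiRel n P)) (Quot.mk (EtaRel nl Pl (cLast nl k)))
  have hQ : IsOpenQuotientMap Q :=
    (fb_quot n P).1.prodMap (eta_quot nl Pl (cLast nl k) (cLast_one _ k) (cLast_mul _ k)).1
  have hq : IsOpenQuotientMap (S.restrictPreimage Q) := hQ.restrictPreimage S
  have hex : ∀ z : Q ⁻¹' S, ∃ b, Phi nl Pl z.1.2.1 b = fun l => z.1.1 (Fin.castLE hj l) :=
    fun z => (fb_quot nl Pl).2 _ _ (Eq.symm z.2)
  choose b hb using hex
  have hbc : Continuous fun z => ((b z (Fin.last j)) : GLC (nl (Fin.last j) + 1)).val := by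
    refine continuous_solve nl Pl (fun z : Q ⁻¹' S => z.1.2.1)
      (fun z => fun l => z.1.1 (Fin.castLE hj l)) b ?_ ?_ hb (Fin.last j)
    · fun_prop
    · exact continuous_pi fun l => (continuous_apply (Fin.castLE hj l)).comp
        (continuous_fst.comp continuous_subtype_val)
  let s : Q ⁻¹' S → EtaTotalC n P c :=
    fun z => Quot.mk _ (z.1.1, cLast nl k (b z) * z.1.2.2)
  have hs : Continuous s := by
    refine continuous_quot_mk.comp (Continuous.prodMk ?_ (Continuous.mul ?_ ?_))
    · fun_prop
    · exact (hbc.matrix_elem k k).inv₀ fun z => BorelT.diag_ne_zero _ _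
    · fun_prop
  have hfs : ∀ z, toPB n P hj k c hc (s z) = S.restrictPreimage Q z := by
    intro z
    refine Subtype.ext (Prod.ext rfl ?_)
    exact (Quot.sound ⟨b z, hb z, rfl⟩ : Quot.mk (EtaRel nl Pl (cLast nl k)) z.1.2 = _).symm
  have hsurj : Function.Surjective (toPB n P hj k c hc) := by
    intro y
    obtain ⟨z, hz⟩ := hq.surjective y
    exact ⟨s z, (hfs z).trans hz⟩
  let E := Equiv.ofBijective _ ⟨toPB_injective n P hj k c hc, hsurj⟩
  refine ⟨{ E with
    continuous_toFun := continuous_toPB n P hj k c hc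
    continuous_invFun := ?_ }, fun x => rfl⟩
  refine hq.continuous_comp_iff.1 ?_
  have : (E.symm ∘ S.restrictPreimage Q) = s := by
    funext z
    show E.symm _ = s z
    rw [Equiv.symm_apply_eq]
    exact (hfs z).symm
  show Continuous (E.symm ∘ S.restrictPreimage Q)
  rw [this]
  exact hs

lemma main_iso
    (hc : ∀ b, c b = cLast (nTr n hj) k (fun l => b (Fin.castLE hj l))) : Nonempty (LineBundleIso
      (PullbackTotal (truncMap n P hj) (wQuotProj (nTr n hj) (PTr n P hj) k))
      (EtaTotalC n P c) (pbProj _ _) (etaProj n P c)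
      (pbSMul _ _ (wQuotSMul (nTr n hj) (PTr n P hj) k) (wQuotProj_smul _ _ _))
      (etaSMul n P c)) := by
  obtain ⟨e, he⟩ := toPB_homeo n P hj k c hc
  let w := wHomeo (nTr n hj) (PTr n P hj) k
  let t : PullbackTotal (truncMap n P hj) (wQuotProj (nTr n hj) (PTr n P hj) k) ≃ₜ
      PullbackTotal (truncMap n P hj)
        (etaProj (nTr n hj) (PTr n P hj) (cLast (nTr n hj) k)) :=
    Homeomorph.subtype ((Homeomorph.refl _).prodCongr w) (fun q => by
      show _ ↔ truncMap n P hj q.1 = etaProj _ _ _ (w q.2)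
      rw [wHomeo_proj])
  refine ⟨⟨t.trans e.symm, ?_, ?_⟩⟩
  · intro x
    obtain ⟨y, hy⟩ := e.surjective (t x)
    show etaProj n P c (e.symm (t x)) = _
    rw [← hy, e.symm_apply_apply]
    rw [he] at hy
    exact congrArg (fun z => z.1.1) hy
  · intro z x
    show e.symm (t _) = etaSMul n P c z (e.symm (t x))
    rw [Homeomorph.symm_apply_eq]
    obtain ⟨y, hy⟩ := e.surjective (t x)
    rw [← hy, e.symm_apply_apply]
    rw [he] at hy
    rw [he]
    refine Subtype.ext (Prod.ext ?_ ?_)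
    · have h1 : etaProj n P c y = x.1.1 := congrArg (fun z => z.1.1) hy
      show x.1.1 = etaProj n P c (etaSMul n P c z y)
      rw [etaProj_smul, h1]
    · have h2 : etaTrunc n P hj k c hc y = w x.1.2 := congrArg (fun z => z.1.2) hy
      show w (wQuotSMul _ _ k z x.1.2) = etaTrunc n P hj k c hc (etaSMul n P c z y)
      rw [wHomeo_smul]
      have h3 : etaTrunc n P hj k c hc (etaSMul n P c z y)
          = etaSMul _ _ _ z (etaTrunc n P hj k c hc y) :=
        Quot.inductionOn y fun _ => rfl
      rw [h3, h2]

end Aux3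

noncomputable section Statement4

/-- Corollary 2.9.
For `1 ≤ l < j ≤ m` (here `j = m` is the top stage and the `l`-th stage is indexed by
`l0 : Fin m`, `l = l0+1`) and `1 ≤ k ≤ n_l+1`, the iterated pullback
`p_j^* ∘ ⋯ ∘ p_{l+1}^*(W_{l,k}/W_{l,k-1}) → B_j^{quo}` of the tautological quotient line
bundle on `B_l^{quo}` is isomorphic, as a line bundle over `B_j^{quo}`, to the line
bundle `η(0,…,0,e_k,0,…,0) → B_j^{quo}` (with `j−l` trailing zero vectors), where
`e_k ∈ ℤ^{n_l+1}` has `1` in the `k`-th place and all other entries zero. -/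
theorem iterated_pullback_wQuot_iso_eta
    {m : ℕ} (n : Fin m → ℕ) (hn : ∀ l, 0 < n l)
    (P : ∀ l j : Fin m, l < j → Matrix (Fin (n j + 1)) (Fin (n l + 1)) ℤ)
    (l0 : Fin m) (hlj : (l0 : ℕ) + 1 < m)
    (k : Fin (nTr n (le_of_lt hlj) (Fin.last (l0 : ℕ)) + 1)) :
    Nonempty (LineBundleIso
      (PullbackTotal (truncMap n P (le_of_lt hlj))
        (wQuotProj (nTr n (le_of_lt hlj)) (PTr n P (le_of_lt hlj)) k))
      (EtaTotal n P
        (fun l i => if (l : ℕ) = (l0 : ℕ) ∧ (i : ℕ) = (k : ℕ) then 1 else 0))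
      (pbProj _ _)
      (etaProj n P (etaCocycle n
        (fun l i => if (l : ℕ) = (l0 : ℕ) ∧ (i : ℕ) = (k : ℕ) then 1 else 0)))
      (pbSMul _ _
        (wQuotSMul (nTr n (le_of_lt hlj)) (PTr n P (le_of_lt hlj)) k)
        (wQuotProj_smul _ _ _))
      (etaSMul n P (etaCocycle n
        (fun l i => if (l : ℕ) = (l0 : ℕ) ∧ (i : ℕ) = (k : ℕ) then 1 else 0)))) := by
  refine main_iso n P (le_of_lt hlj) k _ ?_
  intro b
  unfold etaCocycle cLast
  rw [Finset.prod_eq_single (Fin.castLE (le_of_lt hlj) (Fin.last (l0 : ℕ)))]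
  · unfold charPow
    rw [Finset.prod_eq_single k]
    · simp
    · intro i _ hi
      have hi' : (i : ℕ) ≠ (k : ℕ) := fun h => hi (Fin.ext h)
      simp [hi']
    · simp
  · intro l _ hl
    have hl' : (l : ℕ) ≠ (l0 : ℕ) := fun h => hl (Fin.ext h)
    unfold charPow
    simp [hl']
  · simp

end Statement4
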